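/- arXiv:1810.06172 — 2 statements merged into one kernel-verified Lean document; each statement's English description precedes it below -/
import Mathlib

section
/- Let a be an integer with a ≥ 1. Then Φ(a, 2) equals 1 + i if a ≡ 0 (mod 4), equals 1 if a ≡ 1 (mod 4), equals 0 if a ≡ 2 (mod 4), and equals i if a ≡ 3 (mod 4). -/
open Complex Finset

/-- Normalized quadratic Gauss sum `Φ(a, b) = (1/√a) · Σ_{n=0}^{a−1} exp(πi n² b / a)`. -/
noncomputable def Phi (a b : ℤ) : ℂ :=
  ((Real.sqrt (a : ℝ) : ℝ) : ℂ)⁻¹ *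
    ∑ n ∈ Finset.range a.toNat,
      Complex.exp (Real.pi * Complex.I * (n : ℂ) ^ 2 * (b : ℂ) / (a : ℂ))

open Filter Topology

lemma hasSum_congr_val {f g : ℤ → ℂ} {x y : ℂ} (hfg : ∀ m, g m = f m) (hxy : y = x) :
    HasSum f x ↔ HasSum g y := by
  rw [funext hfg, hxy]

/-- Splitting the theta series by residues modulo `N` and applying the functional equation. -/
lemma theta_split (N : ℕ) [NeZero N] (τ₀ u : ℂ) (hu : 0 < u.im) (h0 : τ₀.im = 0)
    (hper : ∀ (r : ℕ) (m : ℤ), cexp (Real.pi * I * ((m : ℂ) * N + r) ^ 2 * τ₀)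
      = cexp (Real.pi * I * (r : ℂ) ^ 2 * τ₀)) :
    jacobiTheta₂ 0 (τ₀ - 1 / ((N : ℂ) ^ 2 * u)) =
      1 / (I / u) ^ (1 / 2 : ℂ) *
        ∑ r ∈ Finset.range N, cexp (Real.pi * I * (r : ℂ) ^ 2 * τ₀) *
          jacobiTheta₂ ((r : ℂ) / N) u := by
  have hN : (N : ℂ) ≠ 0 := by exact_mod_cast NeZero.ne N
  have hNr : (0 : ℝ) < N := by exact_mod_cast Nat.pos_of_ne_zero (NeZero.ne N)
  have hu0 : u ≠ 0 := by rintro rfl; simp at hu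
  have hv : 0 < (-1 / u).im := by
    rw [neg_div, one_div, neg_im, inv_im, neg_div, neg_neg]
    exact div_pos hu (normSq_pos.mpr hu0)
  have hw : 0 < (τ₀ - 1 / ((N : ℂ) ^ 2 * u)).im := by
    have : τ₀ - 1 / ((N : ℂ) ^ 2 * u) = τ₀ + (((N : ℝ) ^ 2)⁻¹ : ℝ) * (-1 / u) := by
      push_cast; field_simp; ring
    rw [this, add_im, h0, im_ofReal_mul, zero_add]
    positivity
  have hs := hasSum_jacobiTheta₂_term 0 hw
  rw [← (Int.divModEquiv N).symm.hasSum_iff, ← (Equiv.prodComm _ _).hasSum_iff] at hs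
  have key : ∀ r : Fin N, HasSum (fun m : ℤ =>
      (((fun n : ℤ => jacobiTheta₂_term n 0 (τ₀ - 1 / ((N : ℂ) ^ 2 * u))) ∘
        (Int.divModEquiv N).symm) ∘ (Equiv.prodComm _ _)) (r, m))
      (cexp (Real.pi * I * ((r : ℕ) : ℂ) ^ 2 * τ₀) * (1 / (I / u) ^ (1 / 2 : ℂ) *
        jacobiTheta₂ (((r : ℕ) : ℂ) / N) u)) := by
    intro r
    have h1 := hasSum_jacobiTheta₂_term (-((r : ℕ) : ℂ) / (N * u)) hv
    have h2 := h1.mul_left (cexp (Real.pi * I * ((r : ℕ) : ℂ) ^ 2 * τ₀) *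
      cexp (-(Real.pi * I * ((r : ℕ) : ℂ) ^ 2 / ((N : ℂ) ^ 2 * u))))
    refine (hasSum_congr_val ?_ ?_).mp h2
    · intro m
      rw [← hper r m]
      simp only [Function.comp, Equiv.prodComm_apply, Prod.swap, Int.divModEquiv_symm_apply,
        jacobiTheta₂_term, ← Complex.exp_add]
      congr 1
      push_cast
      field_simp
      ring
    · rw [jacobiTheta₂_functional_equation (-((r : ℕ) : ℂ) / (N * u)) (-1 / u)]
      have e1 : -((r : ℕ) : ℂ) / (N * u) / (-1 / u) = ((r : ℕ) : ℂ) / N := by field_simp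
      have e2 : -1 / (-1 / u) = u := by field_simp
      have e3 : -I * (-1 / u) = I / u := by field_simp
      have e4 : -(Real.pi * I * ((r : ℕ) : ℂ) ^ 2 / ((N : ℂ) ^ 2 * u)) +
        -Real.pi * I * (-((r : ℕ) : ℂ) / (N * u)) ^ 2 / (-1 / u) = 0 := by field_simp; ring
      rw [e1, e2, e3]
      have e5 := congrArg cexp e4
      rw [Complex.exp_add, Complex.exp_zero] at e5
      linear_combination (-(cexp (Real.pi * I * ((r : ℕ) : ℂ) ^ 2 * τ₀) *
        (1 / (I / u) ^ (1 / 2 : ℂ) * jacobiTheta₂ (((r : ℕ) : ℂ) / N) u))) * e5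
  have h3 := hs.prod_fiberwise key
  have h4 := h3.unique (hasSum_fintype _)
  rw [h4, Finset.mul_sum, Finset.sum_range]
  refine Finset.sum_congr rfl fun r _ => ?_
  ring

/-- `θ(x, τ) → 1` for real `x` as `Im τ → ∞`. -/
lemma theta_tendsto (x c : ℝ) :
    Tendsto (fun t : ℝ => jacobiTheta₂ (x : ℂ) (I * t + (c : ℂ))) atTop (𝓝 1) := by
  have hlim : ∑' n : ℤ, (if n = 0 then (1 : ℂ) else 0) = 1 := by simp
  rw [← hlim]
  unfold jacobiTheta₂
  have hb := summable_pow_mul_jacobiTheta₂_term_bound 0 one_pos 0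
  refine tendsto_tsum_of_dominated_convergence hb ?_ ?_
  · intro n
    by_cases hn : n = 0
    · subst hn; simp [jacobiTheta₂_term]
    · simp only [hn, if_false]
      rw [tendsto_zero_iff_norm_tendsto_zero]
      simp only [norm_jacobiTheta₂_term]
      refine Real.tendsto_exp_atBot.comp ?_
      have hn2 : (0 : ℝ) < Real.pi * (n : ℝ) ^ 2 := by
        have : (n : ℝ) ≠ 0 := by exact_mod_cast hn
        positivity
      have := (tendsto_id (α := ℝ) (x := atTop)).const_mul_atTop_of_neg (neg_lt_zero.mpr hn2)
      convert this using 2 with t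
      simp
  · filter_upwards [eventually_ge_atTop 1] with t ht n
    rw [pow_zero, one_mul]
    exact norm_jacobiTheta₂_term_le one_pos (by simp) (by simpa using ht) n

lemma real_mul_cpow (t : ℝ) (ht : 0 < t) (z s : ℂ) (hz : z ≠ 0) :
    ((t : ℂ) * z) ^ s = (t : ℂ) ^ s * z ^ s := by
  have ht' : (t : ℂ) ≠ 0 := by exact_mod_cast ht.ne'
  rw [cpow_def_of_ne_zero (mul_ne_zero ht' hz), cpow_def_of_ne_zero ht', cpow_def_of_ne_zero hz,
    Complex.log_ofReal_mul ht hz, ← Complex.exp_add, Complex.ofReal_log ht.le]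
  ring_nf

lemma cancel_aux {p q s A B : ℂ} (hp : p ≠ 0) (hq : q ≠ 0) (hs : s ≠ 0)
    (h : 1 / p * A = 1 / s * (1 / (p * q) * B)) : A * (s * q) = B := by
  field_simp at h
  linear_combination h

lemma gauss_identity (N : ℕ) [NeZero N] (t : ℝ) (ht : 0 < t) :
    (∑ r ∈ Finset.range N, cexp (Real.pi * I * (r : ℂ) ^ 2 * (2 / N)) *
        jacobiTheta₂ ((r : ℂ) / N) (I * t)) *
      ((-I * (2 / N - 1 / ((N : ℂ) ^ 2 * (I * t)))) ^ (1 / 2 : ℂ) *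
        (I * t / (I * t - 1 / (2 * N))) ^ (1 / 2 : ℂ)) =
    ∑ r ∈ Finset.range 2, cexp (Real.pi * I * (r : ℂ) ^ 2 * (-(N : ℂ) / 2)) *
        jacobiTheta₂ ((r : ℂ) / 2) (I * t - 1 / (2 * N)) := by
  have hN : (N : ℂ) ≠ 0 := by exact_mod_cast NeZero.ne N
  have hNr : (0 : ℝ) < N := by exact_mod_cast Nat.pos_of_ne_zero (NeZero.ne N)
  have ht' : (t : ℂ) ≠ 0 := by exact_mod_cast ht.ne'
  have huim : (I * t - 1 / (2 * N)).im = t := by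
    have : (1 / (2 * N) : ℂ) = ((1 / (2 * N) : ℝ) : ℂ) := by push_cast; rfl
    rw [this, sub_im, ofReal_im]; simp
  have hu0 : I * t - 1 / (2 * N) ≠ 0 := by
    intro h; rw [h] at huim; simp at huim; exact ht.ne huim
  have hA := theta_split N (2 / N) (I * t) (by simpa using ht)
    (by have : (2 / N : ℂ) = ((2 / N : ℝ) : ℂ) := by push_cast; rfl
        rw [this, ofReal_im]) (by
      intro r m
      rw [Complex.exp_eq_exp_iff_exists_int]
      refine ⟨m ^ 2 * N + 2 * m * r, ?_⟩
      push_cast; field_simp; ring)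
  have hB := theta_split 2 (-(N : ℂ) / 2) (I * t - 1 / (2 * N)) (by rw [huim]; exact ht)
    (by have : (-(N : ℂ) / 2 : ℂ) = ((-(N : ℝ) / 2 : ℝ) : ℂ) := by push_cast; rfl
        rw [this, ofReal_im]) (by
      intro r m
      rw [Complex.exp_eq_exp_iff_exists_int]
      refine ⟨-(N * (m ^ 2 + m * r)), ?_⟩
      push_cast; field_simp; ring)
  set u := I * t - 1 / (2 * N) with hu
  set τ : ℂ := 2 / N - 1 / ((N : ℂ) ^ 2 * (I * t)) with hτ
  have hττ : τ = 2 * u / (N * (I * t)) := by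
    rw [hτ, hu]; field_simp
  have hτ0 : τ ≠ 0 := by
    rw [hττ]; exact div_ne_zero (mul_ne_zero two_ne_zero hu0) (by simp [hN, ht'])
  have hC := jacobiTheta₂_functional_equation 0 τ
  have e1 : -1 / τ = -(N : ℂ) / 2 - 1 / (((2 : ℕ) : ℂ) ^ 2 * u) := by
    rw [hττ]; push_cast
    have : I * t = u + 1 / (2 * N) := by rw [hu]; ring
    rw [this]
    field_simp
    ring
  rw [zero_div, e1, hB, hA] at hC
  have e2 : I / (I * t) = ((t⁻¹ : ℝ) : ℂ) := by push_cast; field_simp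
  have e3 : I / u = ((t⁻¹ : ℝ) : ℂ) * (I * t / u) := by push_cast; field_simp
  have hz : I * t / u ≠ 0 := div_ne_zero (by simp [ht']) hu0
  rw [e2, e3, real_mul_cpow _ (inv_pos.mpr ht) _ _ hz] at hC
  have p1 : ((t⁻¹ : ℝ) : ℂ) ^ (1 / 2 : ℂ) ≠ 0 := by
    simp [cpow_eq_zero_iff, ht']
  have p2 : (I * t / u) ^ (1 / 2 : ℂ) ≠ 0 := by
    intro h; rw [cpow_eq_zero_iff] at h; exact hz h.1
  have p3 : (-I * τ) ^ (1 / 2 : ℂ) ≠ 0 := by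
    intro h; rw [cpow_eq_zero_iff] at h; simp [hτ0] at h
  simp only [zero_div, Complex.exp_zero, mul_one, ne_eq, OfNat.ofNat_ne_zero, not_false_eq_true,
    zero_pow, mul_zero] at hC
  rw [Nat.cast_ofNat] at hC
  exact cancel_aux p1 p2 p3 hC

lemma gauss_limit (N : ℕ) [NeZero N] :
    (∑ r ∈ Finset.range N, cexp (Real.pi * I * (r : ℂ) ^ 2 * (2 / N))) *
      (-I * (2 / N)) ^ (1 / 2 : ℂ) = 1 + cexp (Real.pi * I * (-(N : ℂ) / 2)) := by
  have hN : (N : ℂ) ≠ 0 := by exact_mod_cast NeZero.ne N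
  have hinv : Tendsto (fun t : ℝ => ((t⁻¹ : ℝ) : ℂ)) atTop (𝓝 0) := by
    have := (continuous_ofReal.tendsto (0 : ℝ)).comp tendsto_inv_atTop_zero
    rw [ofReal_zero] at this
    exact this
  have l1 : Tendsto (fun t : ℝ => ∑ r ∈ Finset.range N,
      cexp (Real.pi * I * (r : ℂ) ^ 2 * (2 / N)) * jacobiTheta₂ ((r : ℂ) / N) (I * t)) atTop
      (𝓝 (∑ r ∈ Finset.range N, cexp (Real.pi * I * (r : ℂ) ^ 2 * (2 / N)) * 1)) := by
    refine tendsto_finsetSum _ fun r _ => ?_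
    refine Tendsto.const_mul _ ?_
    have := theta_tendsto ((r : ℝ) / N) 0
    simpa using this
  have l2 : Tendsto (fun t : ℝ => ∑ r ∈ Finset.range 2,
      cexp (Real.pi * I * (r : ℂ) ^ 2 * (-(N : ℂ) / 2)) *
        jacobiTheta₂ ((r : ℂ) / 2) (I * t - 1 / (2 * N))) atTop
      (𝓝 (∑ r ∈ Finset.range 2, cexp (Real.pi * I * (r : ℂ) ^ 2 * (-(N : ℂ) / 2)) * 1)) := by
    refine tendsto_finsetSum _ fun r _ => ?_
    refine Tendsto.const_mul _ ?_
    have := theta_tendsto ((r : ℝ) / 2) (-(1 / (2 * N)))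
    push_cast at this
    simpa [sub_eq_add_neg] using this
  have l3 : Tendsto (fun t : ℝ => (-I * (2 / N - 1 / ((N : ℂ) ^ 2 * (I * t)))) ^ (1 / 2 : ℂ)) atTop
      (𝓝 ((-I * (2 / N)) ^ (1 / 2 : ℂ))) := by
    refine Tendsto.cpow ?_ tendsto_const_nhds ?_
    · have := ((hinv.const_mul (1 / ((N : ℂ) ^ 2 * I))).const_sub (2 / N : ℂ)).const_mul (-I)
      simp only [mul_zero, sub_zero] at this
      refine this.congr fun t => ?_
      push_cast
      congr 2
      rw [one_div, one_div, mul_inv, mul_inv, mul_inv]; ring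
    · right
      have : -I * (2 / N) = ((2 / N : ℝ) : ℂ) * (-I) := by push_cast; ring
      rw [this, im_ofReal_mul]
      have : (N : ℝ) ≠ 0 := by exact_mod_cast NeZero.ne N
      simp [this]
  have l4 : Tendsto (fun t : ℝ => (I * t / (I * t - 1 / (2 * N))) ^ (1 / 2 : ℂ)) atTop
      (𝓝 1) := by
    have : (1 / (1 - 0) : ℂ) ^ (1 / 2 : ℂ) = 1 := by simp
    refine Eq.subst (motive := fun z : ℂ => Tendsto (fun t : ℝ =>
      (I * t / (I * t - 1 / (2 * N))) ^ (1 / 2 : ℂ)) atTop (𝓝 z)) this ?_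
    refine Tendsto.cpow ?_ tendsto_const_nhds (by simp)
    have h := (hinv.const_mul (1 / (2 * N * I))).const_sub (1 : ℂ)
    rw [mul_zero] at h
    have h' := (tendsto_const_nhds (x := (1 : ℂ))).div h (by simp)
    refine h'.congr' ?_
    filter_upwards [eventually_gt_atTop 0] with t ht
    have ht' : (t : ℂ) ≠ 0 := by exact_mod_cast ht.ne'
    have : I * t - 1 / (2 * N) = I * t * (1 - 1 / (2 * N * I) * ((t⁻¹ : ℝ) : ℂ)) := by
      push_cast; field_simp
    rw [this, div_mul_cancel_left₀ (mul_ne_zero I_ne_zero ht'), ← one_div]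
    rfl
  have h := (l1.mul (l3.mul l4))
  have h' := h.congr' (f₂ := fun t : ℝ => ∑ r ∈ Finset.range 2,
      cexp (Real.pi * I * (r : ℂ) ^ 2 * (-(N : ℂ) / 2)) *
        jacobiTheta₂ ((r : ℂ) / 2) (I * t - 1 / (2 * N))) (by
    filter_upwards [eventually_gt_atTop 0] with t ht
    exact gauss_identity N t ht)
  have := tendsto_nhds_unique h' l2
  simpa [Finset.sum_range_succ] using this

lemma Phi_formula (N : ℕ) [NeZero N] :
    Phi N 2 = (1 + cexp (Real.pi * I * (-(N : ℂ) / 2))) * (1 + I) / 2 := by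
  have hNr : (0 : ℝ) < N := by exact_mod_cast Nat.pos_of_ne_zero (NeZero.ne N)
  have hN : (N : ℂ) ≠ 0 := by exact_mod_cast NeZero.ne N
  have h := gauss_limit N
  have e : (-I * (2 / N)) ^ (1 / 2 : ℂ) = (1 - I) * ((Real.sqrt N : ℝ) : ℂ)⁻¹ := by
    have : -I * (2 / N) = ((2 / N : ℝ) : ℂ) * (-I) := by push_cast; ring
    rw [this, real_mul_cpow _ (by positivity) _ _ (by simp)]
    have e1 : (((2 / N : ℝ)) : ℂ) ^ (1 / 2 : ℂ) = ((Real.sqrt 2 / Real.sqrt N : ℝ) : ℂ) := by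
      rw [← Real.sqrt_div (by norm_num), Real.sqrt_eq_rpow, Complex.ofReal_cpow (by positivity)]
      norm_num
    have e2 : (-I) ^ (1 / 2 : ℂ) = ((Real.sqrt 2 / 2 : ℝ) : ℂ) * (1 - I) := by
      rw [cpow_def_of_ne_zero (by simp), Complex.log_neg_I]
      have : -(Real.pi / 2 : ℂ) * I * (1 / 2) = ((-(Real.pi / 4) : ℝ) : ℂ) * I := by
        push_cast; ring
      rw [this, Complex.exp_mul_I, ← Complex.ofReal_cos, ← Complex.ofReal_sin, Real.cos_neg,
        Real.sin_neg, Real.cos_pi_div_four, Real.sin_pi_div_four]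
      push_cast; ring
    rw [e1, e2]
    have h2 : ((Real.sqrt 2 : ℝ) : ℂ) * ((Real.sqrt 2 : ℝ) : ℂ) = 2 := by
      rw [← Complex.ofReal_mul, Real.mul_self_sqrt (by norm_num)]; norm_num
    push_cast
    linear_combination ((1 - I) * ((Real.sqrt N : ℝ) : ℂ)⁻¹ / 2) * h2
  rw [e] at h
  rw [← h]
  unfold Phi
  have hs : ∀ n : ℕ, cexp (Real.pi * I * (n : ℂ) ^ 2 * ((2 : ℤ) : ℂ) / (((N : ℤ)) : ℂ)) =
      cexp (Real.pi * I * (n : ℂ) ^ 2 * (2 / N)) := by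
    intro n; push_cast; congr 1; ring
  simp only [hs]
  simp only [Int.toNat_natCast, Int.cast_natCast]
  linear_combination (-(((Real.sqrt N : ℝ) : ℂ)⁻¹ * ∑ n ∈ Finset.range N,
    cexp (Real.pi * I * (n : ℂ) ^ 2 * (2 / N))) / 2) * (-I_sq)

lemma exp_aux (N j k : ℕ) (h : N = 4 * k + j) :
    cexp (Real.pi * I * (-(N : ℂ) / 2)) = (-I) ^ j := by
  have hI : cexp (-(Real.pi / 2) * I) = -I := by
    rw [neg_mul, Complex.exp_neg, Complex.exp_pi_div_two_mul_I, Complex.inv_I]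
  rw [← hI, ← Complex.exp_nat_mul, Complex.exp_eq_exp_iff_exists_int]
  refine ⟨-k, ?_⟩
  rw [h]; push_cast; ring

/-- Gauss' evaluation of the quadratic Gauss sum `Φ(a, 2)`. -/
theorem gauss_eval (a : ℤ) (ha : 1 ≤ a) :
    (a % 4 = 0 → Phi a 2 = 1 + Complex.I) ∧
    (a % 4 = 1 → Phi a 2 = 1) ∧
    (a % 4 = 2 → Phi a 2 = 0) ∧
    (a % 4 = 3 → Phi a 2 = Complex.I) := by
  obtain ⟨N, rfl⟩ := Int.eq_ofNat_of_zero_le (by omega : 0 ≤ a)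
  have : NeZero N := ⟨by omega⟩
  have h2 := I_sq
  have h3 : I ^ 3 = -I := by rw [pow_succ, h2]; ring
  refine ⟨fun h => ?_, fun h => ?_, fun h => ?_, fun h => ?_⟩
  · rw [Phi_formula, exp_aux N 0 (N / 4) (by omega)]; ring
  · rw [Phi_formula, exp_aux N 1 (N / 4) (by omega)]; linear_combination (-1 / 2) * h2
  · rw [Phi_formula, exp_aux N 2 (N / 4) (by omega)]; linear_combination (1 + I) / 2 * h2
  · rw [Phi_formula, exp_aux N 3 (N / 4) (by omega)]
    linear_combination (-(1 + I) / 2) * h3 + (1 / 2) * h2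
end

section
/- Let p be an odd prime, l an integer with gcd(l, p) = 1, and k a positive integer. If k is even (so k ≥ 2), then Φ(p^k, 2l) = 1. If k is odd, then Φ(p^k, 2l) = (l/p) · Φ(p^k, 2), where (l/p) is the Legendre symbol. -/
open Complex Finset

theorem gsum_split (A B : ℕ) (f : ℕ → ℂ) :
    ∑ n ∈ Finset.range (A * B), f n =
      ∑ a ∈ Finset.range A, ∑ b ∈ Finset.range B, f (a + A * b) := by
  rw [Finset.sum_comm]
  induction B with
  | zero => simp
  | succ B ih =>
    rw [Nat.mul_succ, Finset.sum_range_add, ih, Finset.sum_range_succ]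
    congr 1
    exact Finset.sum_congr rfl fun x _ => by rw [add_comm]

theorem gsum_zmod (p : ℕ) [NeZero p] (F : ZMod p → ℂ) :
    ∑ n ∈ Finset.range p, F (n : ZMod p) = ∑ x : ZMod p, F x := by
  refine Finset.sum_bij' (fun n _ => (n : ZMod p)) (fun x _ => x.val) ?_ ?_ ?_ ?_ ?_
  · intros; simp
  · intro x _; simpa using ZMod.val_lt x
  · intro n hn; exact ZMod.val_cast_of_lt (by simpa using hn)
  · intro x _; simp
  · intros; rfl

/-- Unnormalized sum. -/
noncomputable def gsumG (m : ℕ) (l : ℤ) : ℂ :=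
  ∑ n ∈ Finset.range m, Complex.exp (2 * Real.pi * Complex.I * (l * (n : ℂ) ^ 2) / (m : ℂ))

theorem gsum_lin (p : ℕ) [NeZero p] (c : ℤ) :
    ∑ b ∈ Finset.range p, Complex.exp (2 * Real.pi * Complex.I * (c * (b : ℂ)) / (p : ℂ)) =
      if (p : ℤ) ∣ c then (p : ℂ) else 0 := by
  have h := AddChar.sum_mulShift (c : ZMod p) (ZMod.isPrimitive_stdAddChar p)
  rw [← gsum_zmod p (fun x => ZMod.stdAddChar (x * (c : ZMod p)))] at h
  simp only [ZMod.card, ZMod.intCast_zmod_eq_zero_iff_dvd] at h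
  push_cast at h
  rw [← h]
  refine Finset.sum_congr rfl fun b _ => ?_
  have := ZMod.stdAddChar_coe (N := p) ((b : ℤ) * c)
  push_cast at this
  rw [this]
  congr 1
  ring

theorem gsum_prime (p : ℕ) [Fact p.Prime] (hodd : Odd p) (l : ℤ) (hl : Int.gcd l (p : ℤ) = 1) :
    gsumG p l = (legendreSym p l : ℂ) * gsumG p 1 := by
  have hp2 : p ≠ 2 := by rintro rfl; exact absurd hodd (by decide)
  have hl0 : ((l : ℤ) : ZMod p) ≠ 0 := by
    rw [Ne, ZMod.intCast_zmod_eq_zero_iff_dvd]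
    intro h
    have : Int.gcd l p = p := by
      simpa using Int.gcd_eq_right (a := l) (b := p) (by positivity) h
    exact (Fact.out : p.Prime).one_lt.ne' (this.symm.trans hl)
  set χ : MulChar (ZMod p) ℂ := (quadraticChar (ZMod p)).ringHomComp (Int.castRingHom ℂ) with hχ
  have key : ∀ m : ℤ, ((m : ℤ) : ZMod p) ≠ 0 → gsumG p m =
      gaussSum χ (AddChar.mulShift ZMod.stdAddChar (m : ZMod p)) := by
    intro m hm
    have h1 : gsumG p m = ∑ x : ZMod p, ZMod.stdAddChar ((m : ZMod p) * x ^ 2) := by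
      rw [← gsum_zmod p (fun x => ZMod.stdAddChar ((m : ZMod p) * x ^ 2))]
      refine Finset.sum_congr rfl fun b _ => ?_
      have := ZMod.stdAddChar_coe (N := p) (m * (b : ℤ) ^ 2)
      push_cast at this
      rw [this]
    have h2 : ∑ x : ZMod p, ZMod.stdAddChar ((m : ZMod p) * x ^ 2) =
        ∑ y : ZMod p, (χ y + 1) * (ZMod.stdAddChar ((m : ZMod p) * y) : ℂ) := by
      rw [← Finset.sum_fiberwise (s := Finset.univ) (g := fun x : ZMod p => x ^ 2)]
      refine Finset.sum_congr rfl fun y _ => ?_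
      have hc := quadraticChar_card_sqrts (F := ZMod p) ((ZMod.ringChar_zmod_n p).substr hp2) y
      have hc' : (χ y + 1 : ℂ) = ((Finset.univ.filter fun x : ZMod p => x ^ 2 = y).card : ℂ) := by
        have : ((quadraticChar (ZMod p) y + 1 : ℤ) : ℂ) = χ y + 1 := by
          simp [hχ]
        rw [← this, ← hc]
        simp
      rw [hc', ← nsmul_eq_mul]
      refine Finset.sum_eq_card_nsmul fun x hx => ?_
      rw [(Finset.mem_filter.1 hx).2]
    have h3 := AddChar.sum_mulShift (m : ZMod p) (ZMod.isPrimitive_stdAddChar p)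
    rw [if_neg hm] at h3
    simp only [mul_comm _ (m : ZMod p)] at h3
    rw [h1, h2]
    simp only [add_mul, one_mul, Finset.sum_add_distrib]
    rw [h3]
    simp [gaussSum, AddChar.mulShift_apply]
  rw [key l hl0, key 1 (by simp)]
  have h := gaussSum_mulShift χ ZMod.stdAddChar (Units.mk0 _ hl0)
  have hχl : χ (l : ZMod p) = (legendreSym p l : ℂ) := by simp [hχ, legendreSym]
  have hsq : (legendreSym p l : ℂ) * (legendreSym p l : ℂ) = 1 := by
    have := legendreSym.sq_one p hl0
    rw [← sq]; exact_mod_cast this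
  simp only [Units.val_mk0] at h
  rw [Int.cast_one, AddChar.mulShift_one, ← h, hχl, ← mul_assoc, hsq, one_mul]

theorem gsum_step (p : ℕ) [Fact p.Prime] (hodd : Odd p) (l : ℤ) (hl : Int.gcd l (p : ℤ) = 1)
    (k : ℕ) : gsumG (p ^ (k + 2)) l = p * gsumG (p ^ k) l := by
  have hp : p.Prime := Fact.out
  have hp0 : (p : ℂ) ≠ 0 := by exact_mod_cast hp.ne_zero
  have hdvd : ∀ a : ℕ, (p : ℤ) ∣ 2 * l * a ↔ p ∣ a := by
    intro a
    have h2 : IsCoprime (p : ℤ) (2 * l) := by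
      refine IsCoprime.mul_right ?_ ?_
      · have := (Nat.coprime_two_right (n := p)).2 hodd
        exact_mod_cast Nat.isCoprime_iff_coprime.2 this
      · exact (Int.isCoprime_iff_gcd_eq_one.2 hl).symm
    exact ⟨fun h => by exact_mod_cast h2.dvd_of_dvd_mul_left h,
      fun h => Dvd.dvd.mul_left (by exact_mod_cast h) _⟩
  have h1 : gsumG (p ^ (k + 2)) l = ∑ a ∈ Finset.range (p * p ^ k),
      Complex.exp (2 * Real.pi * Complex.I * (l * (a : ℂ) ^ 2) / (p : ℂ) ^ (k + 2)) *
        if p ∣ a then (p : ℂ) else 0 := by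
    unfold gsumG
    rw [show p ^ (k + 2) = (p * p ^ k) * p by ring, gsum_split]
    refine Finset.sum_congr rfl fun a _ => ?_
    have := gsum_lin p (2 * l * a)
    simp only [hdvd] at this
    rw [← this, Finset.mul_sum]
    refine Finset.sum_congr rfl fun b _ => ?_
    rw [← Complex.exp_add]
    rw [Complex.exp_eq_exp_iff_exists_int]
    refine ⟨l * p ^ k * b ^ 2, ?_⟩
    push_cast
    field_simp
    ring
  rw [h1, gsum_split, Finset.sum_eq_single 0]
  · unfold gsumG
    rw [Finset.mul_sum]
    refine Finset.sum_congr rfl fun c _ => ?_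
    rw [if_pos (by simp), mul_comm]
    congr 2
    push_cast
    field_simp
    ring
  · intro r hr hr0
    refine Finset.sum_eq_zero fun c _ => ?_
    rw [if_neg, mul_zero]
    intro h
    have h' : p ∣ r := (Nat.dvd_add_left (Dvd.intro _ rfl)).1 h
    exact absurd (Nat.le_of_dvd (Nat.pos_of_ne_zero hr0) h') (by simpa using hr)
  · intro h
    exact absurd (Finset.mem_range.2 hp.pos) h

theorem gsum_phi (m : ℕ) (l : ℤ) :
    Phi (m : ℤ) (2 * l) = ((Real.sqrt (m : ℝ) : ℝ) : ℂ)⁻¹ * gsumG m l := by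
  unfold Phi gsumG
  simp only [Int.toNat_natCast, Int.cast_natCast]
  congr 1
  refine Finset.sum_congr rfl fun n _ => ?_
  congr 1
  push_cast
  ring

theorem gsum_iter (p : ℕ) [Fact p.Prime] (hodd : Odd p) (l : ℤ) (hl : Int.gcd l (p : ℤ) = 1)
    (r j : ℕ) : gsumG (p ^ (r + 2 * j)) l = p ^ j * gsumG (p ^ r) l := by
  induction j with
  | zero => simp
  | succ j ih =>
    rw [show r + 2 * (j + 1) = r + 2 * j + 2 by ring, gsum_step p hodd l hl, ih]
    ring

/-- Evaluation of `Φ(p^k, 2l)` for `p` an odd prime and `gcd(l, p) = 1`. -/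
theorem phi_odd_prime_eval (p : ℕ) [Fact p.Prime] (hodd : Odd p)
    (l : ℤ) (hl : Int.gcd l (p : ℤ) = 1) (k : ℕ) (hk : 1 ≤ k) :
    (Even k → Phi ((p : ℤ) ^ k) (2 * l) = 1) ∧
    (Odd k → Phi ((p : ℤ) ^ k) (2 * l) = (legendreSym p l : ℂ) * Phi ((p : ℤ) ^ k) 2) := by
  have hp : p.Prime := Fact.out
  have hp0 : (p : ℂ) ≠ 0 := by exact_mod_cast hp.ne_zero
  have hc : ((p : ℤ) ^ k) = ((p ^ k : ℕ) : ℤ) := by push_cast; rfl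
  rw [hc]
  constructor
  · rintro ⟨j, rfl⟩
    rw [gsum_phi]
    have h := gsum_iter p hodd l hl 0 j
    rw [zero_add, two_mul] at h
    rw [h]
    have h1 : gsumG (p ^ 0) l = 1 := by simp [gsumG]
    have h2 : Real.sqrt ((p ^ (j + j) : ℕ) : ℝ) = (p : ℝ) ^ j := by
      push_cast
      rw [pow_add]
      exact Real.sqrt_mul_self (by positivity)
    rw [h1, h2]
    push_cast
    field_simp
  · rintro ⟨j, rfl⟩
    have h2 := gsum_phi (p ^ (2 * j + 1)) 1
    rw [mul_one] at h2
    rw [h2, gsum_phi, add_comm, gsum_iter p hodd l hl, gsum_iter p hodd 1 (by simp), pow_one,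
      gsum_prime p hodd l hl]
    ring
end
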